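/- Let h̃ be a C⁷ function on a neighborhood of 0 in ℝ with h̃(0) = 0 and h̃′(0) = 0, satisfying the center manifold equation T̃ sin²((h̃(T̃)−T̃)/3)·(h̃′(T̃) − 1) + T̃ + (3/2) sin((2/3)(h̃(T̃)−T̃)) = 0 identically near 0. Then the [3/3] Padé approximant of θ(T̃) := (h̃(T̃) − T̃)/3 agrees with θ to sixth order: θ(T̃) + (T̃/3)·(1 + (49/135)T̃²)/(1 + (2/5)T̃²) = o(T̃⁶) as T̃ → 0. -/

import Mathlib

open Real Set Filter Asymptotics

/-- Integrating the bound `f' = O(x ^ n)` at `0` gives `f = O(x ^ (n + 1))` when `f 0 = 0`. -/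
lemma isBigO_pow_succ_of_hasDerivAt {f f' : ℝ → ℝ} {n : ℕ}
    (hf : ∀ᶠ x in nhds (0 : ℝ), HasDerivAt f (f' x) x) (hf0 : f 0 = 0)
    (hO : f' =O[nhds 0] fun x => x ^ n) : f =O[nhds 0] fun x => x ^ (n + 1) := by
  obtain ⟨C, hC⟩ := hO.bound
  obtain ⟨ε, hε, hball⟩ := Metric.eventually_nhds_iff_ball.1 (hf.and hC)
  refine IsBigO.of_bound C ?_
  filter_upwards [Metric.ball_mem_nhds (0 : ℝ) hε] with x hx
  have hsub : Metric.closedBall (0 : ℝ) ‖x‖ ⊆ Metric.ball 0 ε :=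
    Metric.closedBall_subset_ball (by simpa using hx)
  have hC0 : 0 ≤ C ∨ x = 0 := by
    by_contra! hcon
    have h1 := (norm_nonneg _).trans (hball x hx).2
    have h2 : 0 < ‖x ^ n‖ := norm_pos_iff.2 (pow_ne_zero _ hcon.2)
    nlinarith
  rcases hC0 with hC0 | rfl
  · have key := (convex_closedBall (0 : ℝ) ‖x‖).norm_image_sub_le_of_norm_hasDerivWithin_le
      (f := f) (f' := f') (C := C * ‖x‖ ^ n)
      (fun y hy => (hball y (hsub hy)).1.hasDerivWithinAt)
      (fun y hy => (hball y (hsub hy)).2.trans (by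
        rw [norm_pow]
        have : ‖y‖ ≤ ‖x‖ := by simpa using hy
        gcongr))
      (Metric.mem_closedBall_self (norm_nonneg x)) (y := x) (by simp)
    simpa [hf0, pow_succ, mul_assoc] using key
  · simp [hf0]

lemma pow_isBigO_pow_of_le {m n : ℕ} (hmn : m ≤ n) :
    (fun x : ℝ => x ^ n) =O[nhds 0] fun x => x ^ m := by
  obtain rfl | hlt := hmn.eq_or_lt
  · exact isBigO_refl _ _
  · exact (isLittleO_pow_pow hlt).isBigO

lemma isBigO_mul_pow {f g : ℝ → ℝ} {m n : ℕ} (hf : f =O[nhds 0] fun x => x ^ m)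
    (hg : g =O[nhds 0] fun x => x ^ n) :
    (fun x => f x * g x) =O[nhds 0] fun x => x ^ (m + n) := by
  simpa only [pow_add] using hf.mul hg

lemma eq_zero_of_const_mul_pow_isBigO {a : ℝ} {n : ℕ}
    (h : (fun x : ℝ => a * x ^ n) =O[nhds 0] fun x => x ^ (n + 1)) : a = 0 := by
  by_contra ha
  have hlo : (fun x : ℝ => x ^ n) =o[nhds 0] fun x : ℝ => x ^ n :=
    ((isBigO_self_const_mul ha _ _).trans h).trans_isLittleO (isLittleO_pow_pow n.lt_succ_self)
  have hne : ∀ᶠ x in nhdsWithin (0 : ℝ) {0}ᶜ, x ^ n ≠ 0 := by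
    filter_upwards [self_mem_nhdsWithin] with x hx using pow_ne_zero _ hx
  exact isLittleO_irrefl hne.frequently (hlo.mono nhdsWithin_le_nhds)

lemma ContDiffAt.deriv_nat {f : ℝ → ℝ} {n : ℕ} {x : ℝ} (hf : ContDiffAt ℝ (n + 1 : ℕ) f x) :
    ContDiffAt ℝ n (deriv f) x := by
  simpa using hf.derivWithin (m := n) (by simp)

lemma exists_isBigO_sub_const_mul_pow {f : ℝ → ℝ} {n : ℕ} (hf : ContDiffAt ℝ (n + 1 : ℕ) f 0)
    (hO : f =O[nhds 0] fun x => x ^ n) :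
    ∃ a : ℝ, (fun x => f x - a * x ^ n) =O[nhds 0] (fun x => x ^ (n + 1)) ∧
      (fun x => deriv f x - a * (n * x ^ (n - 1))) =O[nhds 0] (fun x => x ^ n) := by
  induction n generalizing f with
  | zero =>
    have hd : deriv f =O[nhds 0] fun x : ℝ => x ^ 0 := by
      simpa using hf.deriv_nat.continuousAt.isBigO_one ℝ
    refine ⟨f 0, ?_, by simpa using hd⟩
    refine isBigO_pow_succ_of_hasDerivAt (f' := deriv f) ?_ (by simp) hd
    filter_upwards [hf.eventually (by simp)] with x hx
    simpa using (hx.differentiableAt (by simp)).hasDerivAt.sub_const (f 0)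
  | succ n ih =>
    have hf0 : f 0 = 0 := hO.eq_zero_imp.self_of_nhds (by simp)
    obtain ⟨a, ha, ha'⟩ := ih (hf.of_le (by exact_mod_cast Nat.le_succ _))
      (hO.trans (pow_isBigO_pow_of_le n.le_succ))
    obtain rfl : a = 0 := eq_zero_of_const_mul_pow_isBigO (by simpa using hO.sub ha)
    obtain ⟨b, hb, -⟩ := ih hf.deriv_nat (by simpa using ha')
    have hb' : (fun x => deriv f x - b / (n + 1) * ((n + 1 : ℕ) * x ^ (n + 1 - 1)))
        =O[nhds 0] (fun x => x ^ (n + 1)) := by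
      refine hb.congr_left fun x => ?_
      push_cast
      field_simp
    refine ⟨b / (n + 1), isBigO_pow_succ_of_hasDerivAt ?_ (by simp [hf0]) hb', hb'⟩
    filter_upwards [hf.eventually (by simp)] with x hx
    exact (hx.differentiableAt (by simp)).hasDerivAt.sub ((hasDerivAt_pow _ x).const_mul _)

lemma ContDiffAt.deriv_isBigO_pow {f : ℝ → ℝ} {n : ℕ} (hf : ContDiffAt ℝ (n + 1 : ℕ) f 0)
    (hO : f =O[nhds 0] fun x => x ^ (n + 1)) : deriv f =O[nhds 0] fun x => x ^ n := by
  obtain ⟨a, ha, ha'⟩ :=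
    exists_isBigO_sub_const_mul_pow hf (hO.trans (pow_isBigO_pow_of_le n.le_succ))
  obtain rfl : a = 0 := eq_zero_of_const_mul_pow_isBigO (by simpa using hO.sub ha)
  simpa using ha'

lemma one_sub_cos_isBigO : (fun x : ℝ => 1 - Real.cos x) =O[nhds 0] fun x => x ^ 2 := by
  have hsin : (fun x : ℝ => Real.sin x) =O[nhds 0] fun x => x ^ 1 :=
    isBigO_pow_succ_of_hasDerivAt (.of_forall Real.hasDerivAt_sin) (by simp)
      (by simpa using Real.continuous_cos.continuousAt.isBigO_one ℝ)
  exact isBigO_pow_succ_of_hasDerivAt (.of_forall fun x => by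
    simpa using (Real.hasDerivAt_cos x).const_sub 1) (by simp) hsin

lemma cos_sub_isBigO_pow_four :
    (fun x : ℝ => Real.cos x - (1 - x ^ 2 / 2)) =O[nhds 0] fun x => x ^ 4 := by
  have hsin : (fun x : ℝ => x - Real.sin x) =O[nhds 0] fun x => x ^ 3 :=
    isBigO_pow_succ_of_hasDerivAt (.of_forall fun x =>
      (hasDerivAt_id x).sub (Real.hasDerivAt_sin x)) (by simp) one_sub_cos_isBigO
  refine isBigO_pow_succ_of_hasDerivAt (.of_forall fun x => ?_) (by simp) hsin
  refine HasDerivAt.congr_deriv ((Real.hasDerivAt_cos x).sub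
    (((hasDerivAt_pow 2 x).div_const 2).const_sub 1)) ?_
  push_cast
  ring

lemma cos_sub_isBigO_pow_six :
    (fun x : ℝ => Real.cos x - (1 - x ^ 2 / 2 + x ^ 4 / 24)) =O[nhds 0] fun x => x ^ 6 := by
  have hsin : (fun x : ℝ => Real.sin x - (x - x ^ 3 / 6)) =O[nhds 0] fun x => x ^ 5 := by
    refine isBigO_pow_succ_of_hasDerivAt (.of_forall fun x => ?_) (by simp) cos_sub_isBigO_pow_four
    refine HasDerivAt.congr_deriv ((Real.hasDerivAt_sin x).sub
      ((hasDerivAt_id x).sub ((hasDerivAt_pow 3 x).div_const 6))) ?_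
    push_cast
    ring
  refine isBigO_pow_succ_of_hasDerivAt (.of_forall fun x => ?_) (by simp) hsin.neg_left
  refine HasDerivAt.congr_deriv ((Real.hasDerivAt_cos x).sub
    ((((hasDerivAt_pow 2 x).div_const 2).const_sub 1).add
    ((hasDerivAt_pow 4 x).div_const 24))) ?_
  push_cast
  ring

lemma sin_sub_isBigO_pow_seven :
    (fun x : ℝ => Real.sin x - (x - x ^ 3 / 6 + x ^ 5 / 120)) =O[nhds 0] fun x => x ^ 7 := by
  refine isBigO_pow_succ_of_hasDerivAt (.of_forall fun x => ?_) (by simp) cos_sub_isBigO_pow_six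
  refine HasDerivAt.congr_deriv ((Real.hasDerivAt_sin x).sub (((hasDerivAt_id x).sub
    ((hasDerivAt_pow 3 x).div_const 6)).add ((hasDerivAt_pow 5 x).div_const 120))) ?_
  push_cast
  ring

/-- The degree-five Maclaurin polynomial of the angle along the center manifold. -/
noncomputable def anglePoly (T : ℝ) : ℝ := -T / 3 + T ^ 3 / 81 - 2 * T ^ 5 / 405

/-- The derivative of `anglePoly`. -/
noncomputable def anglePolyDeriv (T : ℝ) : ℝ := -1 / 3 + T ^ 2 / 27 - 2 * T ^ 4 / 81

lemma hasDerivAt_anglePoly (T : ℝ) : HasDerivAt anglePoly (anglePolyDeriv T) T := by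
  unfold anglePoly anglePolyDeriv
  refine HasDerivAt.congr_deriv ((((hasDerivAt_id T).neg.div_const 3).add
    ((hasDerivAt_pow 3 T).div_const 81)).sub
    (((hasDerivAt_pow 5 T).const_mul 2).div_const 405)) ?_
  push_cast
  ring

lemma continuous_anglePolyDeriv : Continuous anglePolyDeriv := by
  unfold anglePolyDeriv
  fun_prop

lemma contDiff_anglePoly {n : WithTop ℕ∞} : ContDiff ℝ n anglePoly := by
  unfold anglePoly
  fun_prop

lemma anglePoly_isBigO : anglePoly =O[nhds 0] fun T => T ^ 1 :=
  isBigO_pow_succ_of_hasDerivAt (.of_forall hasDerivAt_anglePoly) (by simp [anglePoly])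
    (by simpa using continuous_anglePolyDeriv.continuousAt.isBigO_one ℝ)

/-- The residual of the polynomial truncation of the invariance equation at `anglePoly`. -/
lemma anglePoly_residual_isBigO :
    (fun T => 3 * T * (anglePoly T ^ 2 - anglePoly T ^ 4 / 3) * anglePolyDeriv T + T
      + 3 * anglePoly T - 2 * anglePoly T ^ 3 + 2 / 5 * anglePoly T ^ 5)
      =O[nhds 0] fun T => T ^ 7 := by
  have hq : Continuous fun T : ℝ => -64 / 6561 + 3647 / 2657205 * T ^ 2
      - 4316 / 13286025 * T ^ 4 + 114323 / 3228504075 * T ^ 6 - 1890109 / 435848050125 * T ^ 8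
      + 14954 / 29056536675 * T ^ 10 - 15368 / 435848050125 * T ^ 12
      + 9728 / 2179240250625 * T ^ 14 - 112 / 726413416875 * T ^ 16
      + 736 / 54481006265625 * T ^ 18 := by fun_prop
  have hO := (isBigO_refl (fun T : ℝ => T ^ 7) (nhds 0)).mul (hq.continuousAt.isBigO_one ℝ)
  simp only [mul_one] at hO
  refine hO.congr_left fun T => ?_
  unfold anglePoly anglePolyDeriv
  ring

/-- One bootstrap step: the invariance equation improves a bound on the error
`θ - anglePoly` by two orders. -/
lemma error_isBigO_pow_add_two {θ e e' : ℝ → ℝ} {k : ℕ} (hk : k ≤ 4)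
    (hθ : ∀ T, θ T = anglePoly T + e T)
    (hode : ∀ᶠ T in nhds (0 : ℝ), 3 * T * Real.sin (θ T) ^ 2 * (anglePolyDeriv T + e' T) + T
      + 3 / 2 * Real.sin (2 * θ T) = 0)
    (he : e =O[nhds 0] fun T => T ^ (k + 1)) (he' : e' =O[nhds 0] fun T => T ^ k) :
    e =O[nhds 0] fun T => T ^ (k + 3) := by
  have hP := anglePoly_isBigO
  have hD : anglePolyDeriv =O[nhds 0] fun T => T ^ 0 := by
    simpa using continuous_anglePolyDeriv.continuousAt.isBigO_one ℝ
  have hT : (fun T : ℝ => T) =O[nhds 0] fun T => T ^ 1 := by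
    simpa using isBigO_refl (fun T : ℝ => T) (nhds 0)
  have hθO : θ =O[nhds 0] fun T => T ^ 1 :=
    (hP.add (he.trans (pow_isBigO_pow_of_le (by omega)))).congr_left fun T => (hθ T).symm
  have h2θ : (fun T => 2 * θ T) =O[nhds 0] fun T => T ^ 1 := hθO.const_mul_left 2
  have hlim : Tendsto (fun T => 2 * θ T) (nhds 0) (nhds 0) :=
    h2θ.trans_tendsto (by simp only [pow_one]; exact tendsto_id)
  have hS : (fun T => Real.sin (2 * θ T)
      - (2 * θ T - (2 * θ T) ^ 3 / 6 + (2 * θ T) ^ 5 / 120)) =O[nhds 0] fun T => T ^ 7 :=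
    (sin_sub_isBigO_pow_seven.comp_tendsto hlim).trans
      (by simpa [Function.comp_def] using h2θ.pow 7)
  have hK : (fun T => Real.cos (2 * θ T)
      - (1 - (2 * θ T) ^ 2 / 2 + (2 * θ T) ^ 4 / 24)) =O[nhds 0] fun T => T ^ 6 :=
    (cos_sub_isBigO_pow_six.comp_tendsto hlim).trans
      (by simpa [Function.comp_def] using h2θ.pow 6)
  have hsin : (fun T => Real.sin (θ T)) =O[nhds 0] fun T => T ^ 1 :=
    (IsBigO.of_bound 1 (.of_forall fun T => by
      simpa using Real.abs_sin_le_abs (x := θ T))).trans hθO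
  have hs2 : (fun T => Real.sin (θ T) ^ 2) =O[nhds 0] fun T => T ^ 2 := by
    simpa using hsin.pow 2
  have hquad {f g : ℝ → ℝ} (hf : f =O[nhds 0] fun T => T ^ 1)
      (hg : g =O[nhds 0] fun T => T ^ 1) : (fun T => f T * g T) =O[nhds 0] fun T => T ^ 2 :=
    isBigO_mul_pow hf hg
  have hsq : (fun T => θ T * θ T + anglePoly T * anglePoly T) =O[nhds 0] fun T => T ^ 2 :=
    (hquad hθO hθO).add (hquad hP hP)
  have hone : (fun T => 1 - (θ T * θ T + anglePoly T * anglePoly T) / 3)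
      =O[nhds 0] fun T : ℝ => T ^ 0 := by
    have h1 : (fun _ : ℝ => (1 : ℝ)) =O[nhds 0] fun T : ℝ => T ^ 0 := by
      simpa using isBigO_refl (fun _ : ℝ => (1 : ℝ)) (nhds 0)
    refine (h1.sub ((hsq.trans (pow_isBigO_pow_of_le (Nat.zero_le _))).const_mul_left
      (1 / 3))).congr_left fun T => by ring
  have hG1 : (fun T => T * anglePolyDeriv T * (θ T + anglePoly T)
      * (1 - (θ T * θ T + anglePoly T * anglePoly T) / 3)) =O[nhds 0] fun T => T ^ 2 :=
    isBigO_mul_pow (isBigO_mul_pow (isBigO_mul_pow hT hD) (hθO.add hP)) hone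
  have hG2 : (fun T => θ T * θ T + θ T * anglePoly T + anglePoly T * anglePoly T)
      =O[nhds 0] fun T => T ^ 2 :=
    ((hquad hθO hθO).add (hquad hθO hP)).add (hquad hP hP)
  have hG3 : (fun T => (θ T * θ T) * (θ T * θ T + θ T * anglePoly T + anglePoly T * anglePoly T)
      + (anglePoly T * anglePoly T) * (θ T * anglePoly T + anglePoly T * anglePoly T))
      =O[nhds 0] fun T => T ^ 2 :=
    ((isBigO_mul_pow (hquad hθO hθO) hG2).add (isBigO_mul_pow (hquad hP hP)
      ((hquad hθO hP).add (hquad hP hP)))).trans (pow_isBigO_pow_of_le (by norm_num))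
  have hA := isBigO_mul_pow he (((hG1.const_mul_left (-3)).add (hG2.const_mul_left 2)).add
    (hG3.const_mul_left (-2 / 5)))
  have hB := (isBigO_mul_pow (isBigO_mul_pow hT hs2) he').trans
    (pow_isBigO_pow_of_le (show k + 3 ≤ 1 + 2 + k by omega))
  have h7 : (fun T : ℝ => T ^ 7) =O[nhds 0] fun T => T ^ (k + 3) :=
    pow_isBigO_pow_of_le (by omega)
  have hC := (isBigO_mul_pow (isBigO_mul_pow hT hK) hD).trans h7
  have hsum := ((((hA.add (hB.const_mul_left (-3))).add (hC.const_mul_left (3 / 2))).add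
    ((hS.trans h7).const_mul_left (-3 / 2))).sub (anglePoly_residual_isBigO.trans h7)
    ).const_mul_left (1 / 3)
  refine hsum.congr' ?_ .rfl
  filter_upwards [hode] with T hT
  have hs : Real.sin (θ T) ^ 2 = 1 / 2 - Real.cos (2 * θ T) / 2 := Real.sin_sq_eq_half_sub _
  have heT : e T = θ T - anglePoly T := by rw [hθ]; ring
  rw [heT]
  linear_combination (-1 / 3) * hT + T * anglePolyDeriv T * hs

/-- For any C⁷ graph ṽ = h̃(T̃) of the center manifold of dS₊ in the
early-time variables, the [3/3] Padé approximant
−(T̃/3)(1 + (49/135)T̃²)/(1 + (2/5)T̃²) of θ(T̃) = (h̃(T̃) − T̃)/3 agrees with θ to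
sixth order: θ(T̃) + (T̃/3)(1 + (49/135)T̃²)/(1 + (2/5)T̃²) = o(T̃⁶) as T̃ → 0. -/
theorem stmt_16 (h : ℝ → ℝ) (hreg : ContDiffAt ℝ 7 h 0)
    (h0 : h 0 = 0) (h1 : deriv h 0 = 0)
    (hode : ∀ᶠ T in nhds (0:ℝ),
      T * (Real.sin ((h T - T) / 3))^2 * (deriv h T - 1)
        + T + (3/2) * Real.sin ((2/3) * (h T - T)) = 0) :
    (fun T => (h T - T) / 3 + (T / 3) * (1 + (49/135) * T^2) / (1 + (2/5) * T^2))
      =o[nhds (0:ℝ)] (fun T => T^6) := by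
  set e : ℝ → ℝ := fun T => (h T - T) / 3 - anglePoly T with he_def
  have hreg_e : ContDiffAt ℝ 7 e 0 :=
    ((hreg.sub contDiffAt_id).div_const 3).sub contDiff_anglePoly.contDiffAt
  have hde : ∀ᶠ T in nhds (0 : ℝ), deriv e T = (deriv h T - 1) / 3 - anglePolyDeriv T := by
    filter_upwards [hreg.eventually (by simp)] with T hT
    exact ((((hT.differentiableAt (by simp)).hasDerivAt.sub (hasDerivAt_id T)).div_const 3).sub
      (hasDerivAt_anglePoly T)).deriv
  have hode_e : ∀ᶠ T in nhds (0 : ℝ), 3 * T * Real.sin ((h T - T) / 3) ^ 2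
      * (anglePolyDeriv T + deriv e T) + T + 3 / 2 * Real.sin (2 * ((h T - T) / 3)) = 0 := by
    filter_upwards [hode, hde] with T hT hdT
    rw [hdT, show 2 * ((h T - T) / 3) = 2 / 3 * (h T - T) by ring]
    linear_combination hT
  have step (k : ℕ) (hk : k ≤ 4) (he : e =O[nhds 0] fun T => T ^ (k + 1)) :
      e =O[nhds 0] fun T => T ^ (k + 3) :=
    error_isBigO_pow_add_two (θ := fun T => (h T - T) / 3) hk (fun T => by simp [he_def]) hode_e he
      (ContDiffAt.deriv_isBigO_pow
        (hreg_e.of_le (by exact_mod_cast (show k + 1 ≤ 7 by omega))) he)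
  have he1 : e =O[nhds 0] fun T => T ^ (0 + 1) := by
    refine isBigO_pow_succ_of_hasDerivAt (f' := deriv e) ?_ (by simp [he_def, h0, anglePoly]) ?_
    · filter_upwards [hreg_e.eventually (by simp)] with T hT
      exact (hT.differentiableAt (by simp)).hasDerivAt
    · simpa using (ContDiffAt.deriv_nat (n := 6) hreg_e).continuousAt.isBigO_one ℝ
  have he7 : e =O[nhds 0] fun T => T ^ 7 :=
    step 4 le_rfl (step 2 (by norm_num) (step 0 (by norm_num) he1))
  have hrat : (fun T : ℝ => -4 / 2025 * T ^ 7 / (1 + 2 / 5 * T ^ 2)) =O[nhds 0]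
      fun T => T ^ 7 := by
    have hq : Continuous fun T : ℝ => -4 / 2025 / (1 + 2 / 5 * T ^ 2) :=
      Continuous.div (by fun_prop) (by fun_prop) fun T => by positivity
    have hO := (hq.continuousAt.isBigO_one ℝ).mul (isBigO_refl (fun T : ℝ => T ^ 7) (nhds 0))
    simp only [one_mul] at hO
    exact hO.congr_left fun T => by ring
  refine ((he7.add hrat).trans_isLittleO (isLittleO_pow_pow (by norm_num))).congr_left fun T => ?_
  have hne : (1 + 2 / 5 * T ^ 2 : ℝ) ≠ 0 := by positivity
  simp only [he_def, anglePoly]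
  field_simp
  ring
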